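/- Let k be an algebraically closed field, M a finite monoid with group of units G = Mˣ, and assume that the characteristic of k does not divide the order of G (this includes characteristic 0). Let V be a nonzero finite-dimensional kM-module, given by ρ : M → End_k(V), such that ρ(m) = id_V implies m = 1, and let l(n) be the composition-series length of V^{⊗n} as a module over the monoid algebra k[M]. Then l(n)/(dim_k V)^n → 1 as n → ∞ if and only if G is abelian. -/

import Mathlib

open scoped TensorProduct

noncomputable section

/-- The diagonal action of a monoid `M` on the `n`-th tensor power of a module `V`,
`m ↦ ρ(m)^{⊗n}`. -/
def Representation.tensorPower {k M V : Type*} [CommSemiring k] [Monoid M]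
    [AddCommMonoid V] [Module k V] (ρ : Representation k M V) (n : ℕ) :
    Representation k M (⨂[k]^n V) where
  toFun m := PiTensorProduct.map fun _ => ρ m
  map_one' := by
    simp only [map_one]
    exact PiTensorProduct.map_one
  map_mul' m m' := by
    simp only [map_mul]
    exact PiTensorProduct.map_mul _ _

theorem finrank_eq_one_of_isSimpleModule_of_smul_comm {k A S : Type*} [Field k] [IsAlgClosed k]
    [Ring A] [Algebra k A] [AddCommGroup S] [Module k S] [Module A S] [IsScalarTower k A S]
    [FiniteDimensional k S] [IsSimpleModule A S]
    (hcomm : ∀ (a b : A) (x : S), a • b • x = b • a • x) : Module.finrank k S = 1 := by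
  have := IsSimpleModule.nontrivial A S
  obtain ⟨v, hv⟩ := exists_ne (0 : S)
  refine (finrank_eq_one_iff_of_nonzero' v hv).2 fun w => ?_
  obtain ⟨a, rfl⟩ := IsSimpleModule.toSpanSingleton_surjective A hv w
  let φ : Module.End A S :=
    { toFun := fun x => a • x
      map_add' := smul_add a
      map_smul' := fun b x => hcomm a b x }
  obtain ⟨t, ht⟩ := (IsSimpleModule.algebraMap_end_bijective_of_isAlgClosed k).2 φ
  exact ⟨t, LinearMap.congr_fun ht v⟩

theorem finrank_le_finrank_add_one_of_covBy {k A X : Type*} [Field k] [IsAlgClosed k] [Ring A]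
    [Algebra k A] [AddCommGroup X] [Module k X] [Module A X] [IsScalarTower k A X]
    [FiniteDimensional k X] {N N' : Submodule A X} (h : N ⋖ N')
    (hcomm : ∀ (a b : A) (x : X), a • b • x - b • a • x ∈ N) :
    Module.finrank k N' ≤ Module.finrank k N + 1 := by
  have := (covBy_iff_quot_is_simple h.le).1 h
  have : FiniteDimensional k N' :=
    .of_injective (N'.subtype.restrictScalars k) N'.injective_subtype
  have h1 : Module.finrank k (N' ⧸ Submodule.comap N'.subtype N) = 1 := by
    refine finrank_eq_one_of_isSimpleModule_of_smul_comm (A := A) fun a b x => ?_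
    obtain ⟨x, rfl⟩ := Submodule.Quotient.mk_surjective _ x
    simp only [← Submodule.Quotient.mk_smul]
    exact (Submodule.Quotient.eq _).2 (hcomm a b x)
  obtain ⟨v, -, hv⟩ := finrank_eq_one_iff'.1 h1
  obtain ⟨v, rfl⟩ := Submodule.Quotient.mk_surjective _ v
  have hle : N'.restrictScalars k ≤ N.restrictScalars k ⊔ Submodule.span k {(v : X)} := by
    intro x hx
    obtain ⟨t, ht⟩ := hv (Submodule.Quotient.mk ⟨x, hx⟩)
    have hmem : (⟨x, hx⟩ : N') - t • v ∈ Submodule.comap N'.subtype N :=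
      (Submodule.Quotient.eq _).1 ht.symm
    rw [← sub_add_cancel x (t • (v : X))]
    exact Submodule.add_mem_sup hmem (Submodule.smul_mem _ _ (Submodule.mem_span_singleton_self _))
  refine (Submodule.finrank_mono hle).trans
    ((Submodule.finrank_add_le_finrank_add_finrank _ _).trans ?_)
  have hv1 : Module.finrank k (Submodule.span k {(v : X)}) ≤ 1 := by
    simpa using finrank_span_le_card (R := k) {(v : X)}
  exact Nat.add_le_add_left hv1 _

theorem finrank_le_finrank_add_length {k A X : Type*} [Field k] [IsAlgClosed k] [Ring A]
    [Algebra k A] [AddCommGroup X] [Module k X] [Module A X] [IsScalarTower k A X]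
    [FiniteDimensional k X] (W : Submodule A X)
    (hcomm : ∀ (a b : A) (x : X), a • b • x - b • a • x ∈ W)
    (s : CompositionSeries (Submodule A X)) (hbot : s.head = ⊥) (htop : s.last = ⊤) :
    Module.finrank k X ≤ Module.finrank k W + s.length := by
  have key : ∀ (i : ℕ) (hi : i < s.length + 1),
      Module.finrank k ↥(s ⟨i, hi⟩ ⊔ W) ≤ Module.finrank k W + i := by
    intro i
    induction i with
    | zero =>
      intro hi
      have : s ⟨0, hi⟩ = ⊥ := hbot
      rw [this, bot_sup_eq, add_zero]
    | succ i ih =>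
      intro hi
      have hcov : s ⟨i, by omega⟩ ⋖ s ⟨i + 1, hi⟩ := s.step ⟨i, by omega⟩
      have ih' := ih (by omega)
      generalize s ⟨i, by omega⟩ = N at hcov ih'
      generalize s ⟨i + 1, hi⟩ = N' at hcov
      by_cases hle : N' ≤ N ⊔ W
      · have : N' ⊔ W = N ⊔ W :=
          le_antisymm (sup_le hle le_sup_right) (sup_le_sup_right hcov.le W)
        rw [this]
        omega
      · have hinf : N' ⊓ (N ⊔ W) = N := by
          rcases hcov.eq_or_eq (le_inf hcov.le le_sup_left) inf_le_left with h | h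
          · exact h
          · exact absurd (inf_eq_left.1 h) hle
        have hcov' : N ⊔ W ⋖ N' ⊔ W := by
          have := CovBy.sup_of_inf_left (a := N') (b := N ⊔ W) (by rwa [hinf])
          rwa [← sup_assoc, sup_eq_left.2 hcov.le] at this
        have := finrank_le_finrank_add_one_of_covBy (k := k) hcov'
          fun a b x => le_sup_right (a := N) (hcomm a b x)
        omega
  have h := key s.length (Nat.lt_succ_self _)
  have hlast : s ⟨s.length, Nat.lt_succ_self _⟩ = ⊤ := htop
  rw [hlast, top_sup_eq] at h
  have htop' : Module.finrank k ↥(⊤ : Submodule A X) = Module.finrank k X :=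
    finrank_top k X
  rwa [htop'] at h

theorem finrank_add_finrank_inf_ker_add_two_le {k G X : Type*} [Field k] [Group G]
    [AddCommGroup X] [Module k X] [FiniteDimensional k X] (σ : Representation k G X)
    {N N' : Submodule k X} (hlt : N < N') (hN : ∀ g, ∀ x ∈ N, σ g x ∈ N)
    (hN' : ∀ g, ∀ x ∈ N', σ g x ∈ N') {a b c : G} (hc : c * (b * a) = a * b)
    (hr : (orderOf c : k) ≠ 0) :
    Module.finrank k N + Module.finrank k ↥(N ⊓ LinearMap.ker (σ c - 1)) + 2 ≤
      Module.finrank k N' + Module.finrank k ↥(N' ⊓ LinearMap.ker (σ c - 1)) := by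
  have hmono : Module.finrank k ↥(N ⊓ LinearMap.ker (σ c - 1)) ≤
      Module.finrank k ↥(N' ⊓ LinearMap.ker (σ c - 1)) :=
    Submodule.finrank_mono (inf_le_inf_right _ hlt.le)
  have hfin := Submodule.finrank_lt_finrank_of_lt hlt
  by_cases h2 : Module.finrank k N + 2 ≤ Module.finrank k N'
  · omega
  suffices Module.finrank k ↥(N ⊓ LinearMap.ker (σ c - 1)) <
      Module.finrank k ↥(N' ⊓ LinearMap.ker (σ c - 1)) by omega
  obtain ⟨w, hwN', hwN⟩ := Set.exists_of_ssubset hlt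
  have hspan : N ⊔ Submodule.span k {w} = N' := by
    refine Submodule.eq_of_le_of_finrank_le
      (sup_le hlt.le ((Submodule.span_singleton_le_iff_mem _ _).2 hwN')) ?_
    have : N < N ⊔ Submodule.span k {w} :=
      left_lt_sup.2 fun h => hwN (h (Submodule.mem_span_singleton_self w))
    have := Submodule.finrank_lt_finrank_of_lt this
    omega
  have hscalar : ∀ g, ∃ t : k, σ g w - t • w ∈ N := by
    intro g
    have h := hN' g w hwN'
    rw [← hspan, Submodule.mem_sup] at h
    obtain ⟨n, hn, z, hz, hnz⟩ := h
    obtain ⟨t, rfl⟩ := Submodule.mem_span_singleton.1 hz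
    exact ⟨t, by rwa [← hnz, add_sub_cancel_right]⟩
  obtain ⟨s, hs⟩ := hscalar a
  obtain ⟨t, ht⟩ := hscalar b
  have hcomm : σ a (σ b w) - σ b (σ a w) ∈ N := by
    have h1 := N.add_mem (hN a _ ht) (N.smul_mem t hs)
    have h2 := N.add_mem (hN b _ hs) (N.smul_mem s ht)
    convert N.sub_mem h1 h2 using 1
    simp only [map_sub, map_smul, smul_sub, smul_comm s t w]
    abel
  set y := σ (b * a) w with hy
  have hyN : y ∉ N := fun h => hwN <| by
    have := hN (b * a)⁻¹ _ h
    rwa [hy, ← Module.End.mul_apply, ← map_mul, inv_mul_cancel, map_one] at this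
  have hcy : σ c y - y ∈ N := by
    have : σ c y = σ a (σ b w) := by
      simp only [hy, ← Module.End.mul_apply, ← map_mul, hc]
    rw [this]
    simpa [hy] using hcomm
  have hpow : ∀ i : ℕ, σ (c ^ i) y - y ∈ N := by
    intro i
    induction i with
    | zero => simp
    | succ i ih =>
      have h := N.add_mem (hN c _ ih) hcy
      simpa [pow_succ'] using h
  set z := ∑ i ∈ Finset.range (orderOf c), σ (c ^ i) y with hz
  have hzy : z - (orderOf c : k) • y ∈ N := by
    have h := N.sum_mem (t := Finset.range (orderOf c)) fun i _ => hpow i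
    simpa [hz, Finset.sum_sub_distrib, Nat.cast_smul_eq_nsmul] using h
  have hzN : z ∉ N := fun h => hyN <| by
    have h1 := N.sub_mem h hzy
    rw [sub_sub_cancel] at h1
    exact (N.smul_mem_iff hr).1 h1
  have hyN' : y ∈ N' := hN' _ _ hwN'
  have hzN' : z ∈ N' := N'.sum_mem fun i _ => hN' _ _ hyN'
  have hzfix : z ∈ LinearMap.ker (σ c - 1) := by
    have h1 := Finset.sum_range_succ' (fun i => σ (c ^ i) y) (orderOf c)
    rw [Finset.sum_range_succ, pow_orderOf_eq_one, pow_zero] at h1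
    have h2 : σ c z = ∑ i ∈ Finset.range (orderOf c), σ (c ^ (i + 1)) y := by
      simp only [hz, map_sum, pow_succ', map_mul, Module.End.mul_apply]
    rw [LinearMap.mem_ker, LinearMap.sub_apply, Module.End.one_apply, h2, sub_eq_zero]
    exact (add_right_cancel h1).symm
  refine Submodule.finrank_lt_finrank_of_lt (lt_of_le_of_ne (inf_le_inf_right _ hlt.le) ?_)
  intro h
  have : z ∈ N ⊓ LinearMap.ker (σ c - 1) := h ▸ ⟨hzN', hzfix⟩
  exact hzN this.1

theorem PiTensorProduct.finrank_tensorPower {k V : Type*} [Field k] [AddCommGroup V] [Module k V]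
    [FiniteDimensional k V] (n : ℕ) :
    Module.finrank k (⨂[k]^n V) = Module.finrank k V ^ n := by
  have b := Basis.piTensorProduct (fun _ : Fin n => Module.finBasis k V)
  rw [Module.finrank_eq_card_basis b]
  simp

theorem PiTensorProduct.finrank_range_map_le {k V : Type*} [Field k] [AddCommGroup V] [Module k V]
    [FiniteDimensional k V] (n : ℕ) (f : V →ₗ[k] V) :
    Module.finrank k (LinearMap.range (PiTensorProduct.map fun _ : Fin n => f)) ≤
      Module.finrank k (LinearMap.range f) ^ n := by
  have h : (PiTensorProduct.map fun _ : Fin n => f) =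
      (PiTensorProduct.map fun _ : Fin n => (LinearMap.range f).subtype) ∘ₗ
        PiTensorProduct.map fun _ : Fin n => f.rangeRestrict := by
    rw [← PiTensorProduct.map_comp]
    rfl
  rw [← finrank_tensorPower, h]
  have : FiniteDimensional k (⨂[k]^n (LinearMap.range f)) :=
    .of_basis (Basis.piTensorProduct (fun _ : Fin n => Module.finBasis k (LinearMap.range f)))
  exact (Submodule.finrank_mono (LinearMap.range_comp_le_range _ _)).trans
    (LinearMap.finrank_range_le _)

theorem TensorPower.map_mulEquiv {k V : Type*} [CommSemiring k] [AddCommMonoid V] [Module k V]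
    (f : V →ₗ[k] V) {m n : ℕ} (x : ⨂[k]^m V) (y : ⨂[k]^n V) :
    PiTensorProduct.map (fun _ => f) (TensorPower.mulEquiv (x ⊗ₜ[k] y)) =
      TensorPower.mulEquiv
        (PiTensorProduct.map (fun _ => f) x ⊗ₜ[k] PiTensorProduct.map (fun _ => f) y) := by
  induction x using PiTensorProduct.induction_on with
  | add x x' hx hx' => simp only [TensorProduct.add_tmul, map_add, hx, hx']
  | smul_tprod r a =>
    induction y using PiTensorProduct.induction_on with
    | add y y' hy hy' => simp only [TensorProduct.tmul_add, map_add, hy, hy']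
    | smul_tprod t b =>
      simp only [map_smul, ← TensorProduct.smul_tmul', TensorProduct.tmul_smul,
        PiTensorProduct.map_tprod]
      rw [← TensorPower.gMul_def, ← TensorPower.gMul_def, TensorPower.tprod_mul_tprod,
        TensorPower.tprod_mul_tprod, PiTensorProduct.map_tprod]
      congr 3
      funext i
      refine Fin.addCases (fun i => ?_) (fun i => ?_) i <;> simp

theorem TensorPower.finrank_ker_map_sub_one_add_le {k V : Type*} [Field k] [AddCommGroup V]
    [Module k V] [FiniteDimensional k V] {f : V →ₗ[k] V} (hf : f ≠ 1) (n : ℕ) :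
    Module.finrank k (LinearMap.ker (PiTensorProduct.map (fun _ : Fin n => f) - 1)) +
      Module.finrank k (LinearMap.ker (PiTensorProduct.map (fun _ : Fin (n + 1) => f) - 1)) ≤
        Module.finrank k V ^ (n + 1) := by
  obtain ⟨u, hu⟩ : ∃ u, f u ≠ u := by
    by_contra! h
    exact hf (LinearMap.ext h)
  have hfin (m : ℕ) : FiniteDimensional k (⨂[k]^m V) :=
    .of_basis (Basis.piTensorProduct (fun _ : Fin m => Module.finBasis k V))
  let ι : V ≃ₗ[k] ⨂[k]^1 V := (PiTensorProduct.subsingletonEquiv (s := fun _ => V) (0 : Fin 1)).symm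
  have hι (v : V) : PiTensorProduct.map (fun _ : Fin 1 => f) (ι v) = ι (f v) := by
    simp [ι, PiTensorProduct.subsingletonEquiv_symm_apply']
  let φ : ⨂[k]^n V →ₗ[k] ⨂[k]^(n + 1) V :=
    TensorPower.mulEquiv.toLinearMap ∘ₗ (TensorProduct.mk k _ _).flip (ι (f u - u))
  have hφ : Function.Injective φ := by
    refine TensorPower.mulEquiv.injective.comp ?_
    have hinj : Function.Injective (LinearMap.toSpanSingleton k _ (ι (f u - u))) :=
      LinearMap.ker_eq_bot.1 <| LinearMap.ker_toSpanSingleton k <| by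
        rwa [Ne, map_eq_zero_iff ι ι.injective, sub_eq_zero]
    have h := (Module.Flat.lTensor_preserves_injective_linearMap (M := ⨂[k]^n V) _ hinj).comp
      (TensorProduct.rid k (⨂[k]^n V)).symm.injective
    convert h using 1
    ext w
    simp [TensorProduct.tmul_sub]
  have hle : (LinearMap.ker (PiTensorProduct.map (fun _ : Fin n => f) - 1)).map φ ≤
      LinearMap.range (PiTensorProduct.map (fun _ : Fin (n + 1) => f) - 1) := by
    rintro _ ⟨w, hw, rfl⟩
    have hw' : PiTensorProduct.map (fun _ : Fin n => f) w = w := sub_eq_zero.1 hw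
    refine ⟨TensorPower.mulEquiv (w ⊗ₜ ι u), ?_⟩
    rw [LinearMap.sub_apply, TensorPower.map_mulEquiv, hw', hι, Module.End.one_apply, ← map_sub,
      ← TensorProduct.tmul_sub, ← map_sub]
    rfl
  have h1 : Module.finrank k (LinearMap.ker (PiTensorProduct.map (fun _ : Fin n => f) - 1)) ≤
      Module.finrank k
        (LinearMap.range (PiTensorProduct.map (fun _ : Fin (n + 1) => f) - 1)) :=
    (Submodule.equivMapOfInjective φ hφ _).finrank_eq.trans_le (Submodule.finrank_mono hle)
  have h2 := LinearMap.finrank_range_add_finrank_ker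
    (PiTensorProduct.map (fun _ : Fin (n + 1) => f) - 1 : ⨂[k]^(n + 1) V →ₗ[k] ⨂[k]^(n + 1) V)
  rw [PiTensorProduct.finrank_tensorPower] at h2
  omega

theorem IsUnit.of_mul_right_of_finite {M : Type*} [Monoid M] [Finite M] {a b : M}
    (h : IsUnit (a * b)) : IsUnit b := by
  obtain ⟨c, hc⟩ := h.exists_left_inv
  rw [← mul_assoc] at hc
  have hinj : Function.Injective (b * ·) := fun x y hxy => by
    simpa [← mul_assoc, hc] using congrArg (c * a * ·) hxy
  obtain ⟨d, hd⟩ := Finite.surjective_of_injective hinj 1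
  exact isUnit_iff_exists.2 ⟨d, hd, by rwa [← left_inv_eq_right_inv hc hd]⟩

theorem Representation.isUnit_of_injective {k M V : Type*} [CommSemiring k] [Monoid M] [Finite M]
    [AddCommMonoid V] [Module k V] (ρ : Representation k M V) (hρ : ∀ m : M, ρ m = 1 → m = 1)
    {m : M} (hm : Function.Injective (ρ m)) : IsUnit m := by
  obtain ⟨i, j, hij, h⟩ := Finite.exists_ne_map_eq_of_infinite fun n : ℕ => m ^ n
  wlog hlt : i < j generalizing i j
  · exact this j i hij.symm h.symm (by omega)
  refine IsUnit.of_pow_eq_one (n := j - i) (hρ _ (LinearMap.ext fun v => ?_)) (by omega)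
  have hinj : Function.Injective (ρ (m ^ i)) := by
    rw [map_pow, Module.End.coe_pow]
    exact hm.iterate i
  apply hinj
  rw [← Module.End.mul_apply, ← map_mul, ← pow_add, Nat.add_sub_cancel' hlt.le, ← h]
  rfl

theorem Submodule.finrank_finset_sup_le {k X ι : Type*} [Field k] [AddCommGroup X] [Module k X]
    [FiniteDimensional k X] (s : Finset ι) (p : ι → Submodule k X) :
    Module.finrank k ↥(s.sup p) ≤ ∑ i ∈ s, Module.finrank k (p i) := by
  classical
  induction s using Finset.induction_on with
  | empty => simp
  | insert i s hi ih =>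
    rw [Finset.sup_insert, Finset.sum_insert hi]
    exact (Submodule.finrank_add_le_finrank_add_finrank _ _).trans (Nat.add_le_add_left ih _)

namespace Representation

variable {k M X : Type*} [Field k] [Monoid M] [AddCommGroup X] [Module k X]
  (τ : Representation k M X)

theorem two_mul_length_le [FiniteDimensional k X]
    {a b c : Mˣ} (hc : c * (b * a) = a * b) (hr : (orderOf c : k) ≠ 0)
    (s : CompositionSeries (Submodule (MonoidAlgebra k M) τ.asModule)) :
    2 * s.length ≤ Module.finrank k X + Module.finrank k (LinearMap.ker (τ c - 1)) := by
  let Φ (N : Submodule (MonoidAlgebra k M) τ.asModule) : Submodule k X :=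
    (N.restrictScalars k).map τ.asModuleEquiv.toLinearMap
  have hΦ {N N'} (h : N < N') : Φ N < Φ N' :=
    Submodule.map_strictMono_of_injective (f := τ.asModuleEquiv.toLinearMap)
      τ.asModuleEquiv.injective h
  have hstable (N) (m : M) (x : X) (hx : x ∈ Φ N) : τ m x ∈ Φ N := by
    obtain ⟨y, hy, rfl⟩ := hx
    refine ⟨MonoidAlgebra.of k M m • y, N.smul_mem _ hy, ?_⟩
    rw [LinearEquiv.coe_coe, asModuleEquiv_map_smul, asAlgebraHom_of]
  have key : ∀ (i : ℕ) (hi : i < s.length + 1), 2 * i ≤ Module.finrank k (Φ (s ⟨i, hi⟩)) +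
      Module.finrank k ↥(Φ (s ⟨i, hi⟩) ⊓ LinearMap.ker (τ c - 1)) := by
    intro i
    induction i with
    | zero => intro; omega
    | succ i ih =>
      intro hi
      have hlt : s ⟨i, by omega⟩ < s ⟨i + 1, hi⟩ := (s.step ⟨i, by omega⟩).lt
      have hstep : Module.finrank k (Φ (s ⟨i, by omega⟩)) +
          Module.finrank k ↥(Φ (s ⟨i, by omega⟩) ⊓ LinearMap.ker (τ c - 1)) + 2 ≤
            Module.finrank k (Φ (s ⟨i + 1, hi⟩)) +
              Module.finrank k ↥(Φ (s ⟨i + 1, hi⟩) ⊓ LinearMap.ker (τ c - 1)) :=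
        finrank_add_finrank_inf_ker_add_two_le (τ.comp (Units.coeHom M)) (hΦ hlt)
          (fun g => hstable _ g) (fun g => hstable _ g) hc hr
      have := ih (by omega)
      omega
  exact (key s.length (Nat.lt_succ_self _)).trans
    (Nat.add_le_add (Submodule.finrank_le _) (Submodule.finrank_mono inf_le_right))

theorem finrank_le_sum_finrank_range_add_length [Fintype M] [DecidablePred (IsUnit : M → Prop)]
    [IsAlgClosed k] [FiniteDimensional k X] (hcomm : ∀ a b : Mˣ, a * b = b * a)
    (s : CompositionSeries (Submodule (MonoidAlgebra k M) τ.asModule))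
    (hbot : s.head = ⊥) (htop : s.last = ⊤) :
    Module.finrank k X ≤
      ∑ m : M with ¬ IsUnit m, Module.finrank k (LinearMap.range (τ m)) + s.length := by
  let W₀ : Submodule k X := (Finset.univ.filter fun m : M => ¬ IsUnit m).sup
    fun m => LinearMap.range (τ m)
  have hmem (m : M) (hm : ¬ IsUnit m) (x : X) : τ m x ∈ W₀ :=
    Finset.le_sup (f := fun m => LinearMap.range (τ m)) (by simpa using hm)
      (LinearMap.mem_range_self _ x)
  have hstable (m : M) : W₀ ≤ W₀.comap (τ m) := by
    refine Finset.sup_le fun m' hm' => ?_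
    rintro _ ⟨x, rfl⟩
    rw [Submodule.mem_comap, ← Module.End.mul_apply, ← map_mul]
    exact hmem _ (fun h => (Finset.mem_filter.1 hm').2 h.of_mul_right_of_finite) x
  let W : Submodule (MonoidAlgebra k M) τ.asModule :=
    MonoidAlgebra.submoduleOfSMulMem (W₀.comap τ.asModuleEquiv.toLinearMap) fun m x hx => by
      rw [Submodule.mem_comap, LinearEquiv.coe_coe, asModuleEquiv_map_smul, asAlgebraHom_of]
      exact hstable m hx
  have hW (x) : x ∈ W ↔ τ.asModuleEquiv x ∈ W₀ := Iff.rfl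
  have hfin : Module.finrank k W ≤ Module.finrank k W₀ := by
    refine LinearMap.finrank_le_finrank_of_injective
      (f := (τ.asModuleEquiv.toLinearMap ∘ₗ W.subtype.restrictScalars k).codRestrict W₀
        fun x => (hW x).1 x.2) ?_
    intro x y hxy
    exact Subtype.ext (τ.asModuleEquiv.injective (congrArg Subtype.val hxy))
  have hcommW (a b : MonoidAlgebra k M) (x : τ.asModule) : a • b • x - b • a • x ∈ W := by
    induction a using MonoidAlgebra.induction_on with
    | add a a' h h' =>
      convert W.add_mem h h' using 1
      simp only [add_smul, smul_add]
      abel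
    | smul r a h =>
      rw [← W.restrictScalars_mem k] at h ⊢
      convert (W.restrictScalars k).smul_mem r h using 1
      simp only [smul_assoc, smul_sub, smul_comm b r]
    | of m =>
      induction b using MonoidAlgebra.induction_on with
      | add a a' h h' =>
        convert W.add_mem h h' using 1
        simp only [add_smul, smul_add]
        abel
      | smul r a h =>
        rw [← W.restrictScalars_mem k] at h ⊢
        convert (W.restrictScalars k).smul_mem r h using 1
        simp only [smul_assoc, smul_sub, smul_comm _ r]
      | of m' =>
        rw [hW, map_sub]
        simp only [asModuleEquiv_map_smul, asAlgebraHom_of]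
        by_cases hm : IsUnit m
        · by_cases hm' : IsUnit m'
          · obtain ⟨u, rfl⟩ := hm
            obtain ⟨v, rfl⟩ := hm'
            simp only [← Module.End.mul_apply, ← map_mul, ← Units.val_mul, hcomm u v, sub_self,
              W₀.zero_mem]
          · exact W₀.sub_mem (hstable _ (hmem _ hm' _)) (hmem _ hm' _)
        · exact W₀.sub_mem (hmem _ hm _) (hstable _ (hmem _ hm _))
  have := finrank_le_finrank_add_length (k := k) W hcommW s hbot htop
  rw [LinearEquiv.finrank_eq τ.asModuleEquiv] at this
  have hsum : Module.finrank k W₀ ≤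
      ∑ m : M with ¬ IsUnit m, Module.finrank k (LinearMap.range (τ m)) :=
    Submodule.finrank_finset_sup_le _ _
  omega

end Representation

/-- Let `k` be an algebraically closed field and `M` a finite monoid with group of units
`G = Mˣ`, where `char k` does not divide `|G|`. Let `V` be a nonzero finite-dimensional
`kM`-module such that `ρ(m) = id_V` implies `m = 1`, and let `l(n)` be the
composition-series length of `V^{⊗n}` over the monoid algebra `k[M]`. Then
`l(n)/(dim_k V)^n → 1` as `n → ∞` if and only if `G` is abelian. -/
theorem tendsto_length_div_dim_pow_iff_units_commutative
    {k M V : Type*} [Field k] [IsAlgClosed k] [Monoid M] [Fintype M]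
    (hchar : ¬(ringChar k ∣ Nat.card Mˣ))
    [AddCommGroup V] [Module k V] [FiniteDimensional k V] [Nontrivial V]
    (ρ : Representation k M V) (hρ : ∀ m : M, ρ m = 1 → m = 1)
    (l : ℕ → ℕ)
    (hl : ∀ n : ℕ, ∃ s : CompositionSeries
        (Submodule (MonoidAlgebra k M) ((ρ.tensorPower n).asModule)),
        s.head = ⊥ ∧ s.last = ⊤ ∧ s.length = l n) :
    Filter.Tendsto (fun n : ℕ => (l n : ℝ) / ((Module.finrank k V : ℝ) ^ n))
      Filter.atTop (nhds 1) ↔ ∀ a b : Mˣ, a * b = b * a := by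
  have hd : 0 < Module.finrank k V := Module.finrank_pos
  set d := Module.finrank k V with hd_def
  have hdR : (0 : ℝ) < d := Nat.cast_pos.2 hd
  have hfin (n : ℕ) : FiniteDimensional k (⨂[k]^n V) :=
    .of_basis (Basis.piTensorProduct fun _ : Fin n => Module.finBasis k V)
  have hbound {a b c : Mˣ} (hc : c * (b * a) = a * b) (hr : (orderOf c : k) ≠ 0) (n : ℕ) :
      2 * l n ≤ d ^ n + Module.finrank k (LinearMap.ker (ρ.tensorPower n c - 1)) := by
    obtain ⟨s, -, -, hs⟩ := hl n
    rw [← hs, ← PiTensorProduct.finrank_tensorPower]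
    exact (ρ.tensorPower n).two_mul_length_le hc hr s
  constructor
  · intro hlim
    by_contra! hne
    obtain ⟨a, b, hab⟩ := hne
    set c := a * b * (b * a)⁻¹
    have hc : c * (b * a) = a * b := inv_mul_cancel_right _ _
    have hc1 : ρ c ≠ 1 := fun h => hab <| by
      have h1 : c = 1 := Units.ext (hρ _ h)
      rw [← hc, h1, one_mul]
    have hr : (orderOf c : k) ≠ 0 := fun h =>
      hchar (((ringChar.spec k _).1 h).trans (orderOf_dvd_natCard c))
    have hsum (n : ℕ) : 2 * l n + 2 * l (n + 1) ≤ d ^ n + 2 * d ^ (n + 1) := by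
      have h1 := hbound hc hr n
      have h2 := hbound hc hr (n + 1)
      have h3 : Module.finrank k (LinearMap.ker (ρ.tensorPower n c - 1)) +
          Module.finrank k (LinearMap.ker (ρ.tensorPower (n + 1) c - 1)) ≤ d ^ (n + 1) :=
        TensorPower.finrank_ker_map_sub_one_add_le hc1 n
      omega
    have hlim' := (hlim.const_mul 2).add
      ((hlim.comp (Filter.tendsto_add_atTop_nat 1)).const_mul (2 * (d : ℝ)))
    have hle := le_of_tendsto' (b := 1 + 2 * (d : ℝ)) hlim' fun n => by
      have h : 2 * (l n : ℝ) + 2 * l (n + 1) ≤ d ^ n + 2 * d ^ (n + 1) := mod_cast hsum n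
      have hpow : (0 : ℝ) < (d : ℝ) ^ n := pow_pos hdR n
      have heq : 2 * ((l n : ℝ) / (d : ℝ) ^ n) + 2 * d * ((l (n + 1) : ℝ) / (d : ℝ) ^ (n + 1)) =
          (2 * (l n : ℝ) + 2 * l (n + 1)) / (d : ℝ) ^ n := by
        rw [pow_succ]
        field_simp
      simp only [Function.comp_apply]
      rw [heq, div_le_iff₀ hpow]
      calc _ ≤ _ := h
        _ = _ := by ring
    linarith
  · intro hcomm
    classical
    have hlower (n : ℕ) : d ^ n ≤ Fintype.card M * (d - 1) ^ n + l n := by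
      obtain ⟨s, hbot, htop, hs⟩ := hl n
      rw [← hs, hd_def, ← PiTensorProduct.finrank_tensorPower]
      refine ((ρ.tensorPower n).finrank_le_sum_finrank_range_add_length hcomm s hbot htop).trans
        (Nat.add_le_add_right ?_ _)
      refine (Finset.sum_le_card_nsmul _ _ ((d - 1) ^ n) fun m hm => ?_).trans
        (Nat.mul_le_mul_right _ (Finset.card_le_univ _))
      refine (PiTensorProduct.finrank_range_map_le n (ρ m)).trans (Nat.pow_le_pow_left ?_ n)
      have hlt : Module.finrank k (LinearMap.range (ρ m)) < d :=
        Submodule.finrank_lt fun h => (Finset.mem_filter.1 hm).2 <|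
          ρ.isUnit_of_injective hρ (LinearMap.injective_iff_surjective.2
            (LinearMap.range_eq_top.1 h))
      omega
    have hupper (n : ℕ) : l n ≤ d ^ n := by
      have h1 := hbound (a := 1) (b := 1) (c := 1) (by simp) (by simp) n
      have h2 : Module.finrank k (LinearMap.ker (ρ.tensorPower n (1 : Mˣ) - 1)) ≤ d ^ n := by
        rw [hd_def, ← PiTensorProduct.finrank_tensorPower]
        exact Submodule.finrank_le _
      omega
    have hq : Filter.Tendsto (fun n : ℕ => 1 - Fintype.card M * (((d - 1 : ℕ) : ℝ) / d) ^ n)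
        Filter.atTop (nhds 1) := by
      have hlt : ((d - 1 : ℕ) : ℝ) / d < 1 := by
        rw [div_lt_one hdR]
        exact_mod_cast Nat.sub_lt hd one_pos
      simpa using ((tendsto_pow_atTop_nhds_zero_of_lt_one (by positivity) hlt).const_mul
        (Fintype.card M : ℝ)).const_sub 1
    refine tendsto_of_tendsto_of_tendsto_of_le_of_le hq tendsto_const_nhds
      (fun n => ?_) (fun n => ?_)
    · have h : (d : ℝ) ^ n ≤ Fintype.card M * ((d - 1 : ℕ) : ℝ) ^ n + l n := mod_cast hlower n
      have hpow : (0 : ℝ) < (d : ℝ) ^ n := pow_pos hdR n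
      simp only
      rw [div_pow, le_div_iff₀ hpow, sub_mul, one_mul, mul_assoc, div_mul_cancel₀ _ hpow.ne']
      linarith
    · simp only
      rw [div_le_one (pow_pos hdR n)]
      exact_mod_cast hupper n

end
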